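/- (Willems' Fundamental Lemma.) Let A ∈ ℝ^{n×n}, B ∈ ℝ^{n×m}, C ∈ ℝ^{p×n}, D ∈ ℝ^{p×m}, and suppose the pair (A,B) is controllable, i.e., the controllability matrix [B, AB, …, A^{n−1}B] ∈ ℝ^{n×(nm)} has rank n. Let T, L be positive integers with L + n ≤ T, and let (u^d, x^d, y^d) be data generated by the system, i.e., u^d : Fin T → ℝ^m, x^d : Fin (T+1) → ℝ^n, y^d : Fin T → ℝ^p with x^d(t+1) = A x^d(t) + B u^d(t) and y^d(t) = C x^d(t) + D u^d(t) for all 0 ≤ t ≤ T−1. Assume u^d is persistently exciting of order L + n, i.e., the block Hankel matrix H_{L+n}(u^d) ∈ ℝ^{m(L+n) × (T−L−n+1)} has full row rank m(L+n). Then for every pair (u, y) with u : Fin L → ℝ^m and y : Fin L → ℝ^p, the following are equivalent: (i) there exists g ∈ ℝ^{T−L+1} such that H_L(u^d) g equals the stacked vector of u and H_L(y^d) g equals the stacked vector of y; (ii) (u, y) is a length-L input–output trajectory of the system, i.e., there exists x : Fin (L+1) → ℝ^n with x(t+1) = A x(t) + B u(t) and y(t) = C x(t) + D u(t) for all 0 ≤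 t ≤ L−1. -/

import Mathlib

/-- The block Hankel matrix of depth `L` of a signal `w : Fin T → Fin q → ℝ`.
Its rows are indexed by block pairs `(i, k) : Fin L × Fin q` and its `j`-th column
is the stacked vector `(w j, w (j+1), …, w (j+L-1))`. -/
def blockHankel (T L q : ℕ) (hL : L ≤ T) (w : Fin T → Fin q → ℝ) :
    Matrix (Fin L × Fin q) (Fin (T - L + 1)) ℝ :=
  Matrix.of fun ik j =>
    w ⟨ik.1.1 + j.1, by have h1 := ik.1.isLt; have h2 := j.isLt; omega⟩ ik.2

/-- The controllability matrix `[B, AB, …, A^{n−1}B]` of a pair `(A, B)`,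
with columns indexed by `Fin n × Fin m`. -/
def ctrbMatrix (n m : ℕ) (A : Matrix (Fin n) (Fin n) ℝ) (B : Matrix (Fin n) (Fin m) ℝ) :
    Matrix (Fin n) (Fin n × Fin m) ℝ :=
  Matrix.of fun i kj => (A ^ (kj.1 : ℕ) * B) i kj.2

open Matrix

theorem vecMul_injective_of_rank_eq_card {ι κ : Type*} [Fintype ι] [Fintype κ]
    (M : Matrix ι κ ℝ) (h : M.rank = Fintype.card ι) (v : ι → ℝ) (hv : v ᵥ* M = 0) : v = 0 := by
  have hli : LinearIndependent ℝ M.row := by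
    rw [linearIndependent_iff_card_eq_finrank_span, ← h, rank_eq_finrank_span_row]
    rfl
  exact (vecMul_injective_iff.2 hli) (by simpa using hv)

theorem mulVec_surjective_of_vecMul_eq_zero {ι κ : Type*} [Fintype ι] [Fintype κ]
    (M : Matrix ι κ ℝ) (h : ∀ v : ι → ℝ, v ᵥ* M = 0 → v = 0) (b : ι → ℝ) :
    ∃ g : κ → ℝ, M *ᵥ g = b := by
  have hli : LinearIndependent ℝ M.row := vecMul_injective_iff.1 (by
    intro v w hvw
    exact sub_eq_zero.1 (h _ (by rw [sub_vecMul]; exact sub_eq_zero.2 hvw)))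
  have hr := hli.rank_matrix
  have : LinearMap.range M.mulVecLin = ⊤ :=
    Submodule.eq_top_of_finrank_eq (by rw [Module.finrank_fintype_fun_eq_card]; exact hr)
  exact LinearMap.range_eq_top.1 this b

/-- Variation of constants, tested against a row vector. -/
theorem dotProduct_state_eq {n m : ℕ} (A : Matrix (Fin n) (Fin n) ℝ)
    (B : Matrix (Fin n) (Fin m) ℝ) (x : ℕ → Fin n → ℝ) (u : ℕ → Fin m → ℝ) (j k : ℕ)
    (hx : ∀ t < j + k, x (t + 1) = A *ᵥ x t + B *ᵥ u t) (ξ : Fin n → ℝ) :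
    ξ ⬝ᵥ x (j + k) = (ξ ᵥ* A ^ k) ⬝ᵥ x j +
      ∑ s ∈ Finset.range k, (ξ ᵥ* (A ^ (k - 1 - s) * B)) ⬝ᵥ u (j + s) := by
  induction k generalizing ξ with
  | zero => simp
  | succ k ih =>
    rw [← add_assoc, hx (j + k) (by omega), dotProduct_add, dotProduct_mulVec, dotProduct_mulVec,
      ih (fun t ht => hx t (by omega)), Finset.sum_range_succ, vecMul_vecMul, ← pow_succ']
    have : ∀ s ∈ Finset.range k, ((ξ ᵥ* A) ᵥ* (A ^ (k - 1 - s) * B)) ⬝ᵥ u (j + s) =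
        (ξ ᵥ* (A ^ (k + 1 - 1 - s) * B)) ⬝ᵥ u (j + s) := by
      intro s hs
      have hs := Finset.mem_range.1 hs
      rw [vecMul_vecMul, ← Matrix.mul_assoc, ← pow_succ',
        show k - 1 - s + 1 = k + 1 - 1 - s by omega]
    rw [Finset.sum_congr rfl this]
    simp [add_assoc]

/-- The descending sequence `ξAⁿ⁻¹B, …, ξB, η₀, …, η_{L-1}, 0, 0, …`. -/
def annihilatorSeq {n m : ℕ} (A : Matrix (Fin n) (Fin n) ℝ) (B : Matrix (Fin n) (Fin m) ℝ)
    (ξ : Fin n → ℝ) (L : ℕ) (η : ℕ → Fin m → ℝ) (i : ℕ) : Fin m → ℝ :=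
  if i < n then ξ ᵥ* (A ^ (n - 1 - i) * B) else if i < n + L then η (i - n) else 0

theorem annihilatorSeq_shift {n m : ℕ} (A : Matrix (Fin n) (Fin n) ℝ)
    (B : Matrix (Fin n) (Fin m) ℝ) (x : ℕ → Fin n → ℝ) (u : ℕ → Fin m → ℝ) (L j k : ℕ)
    (hk : k ≤ n) (hx : ∀ t < j + k, x (t + 1) = A *ᵥ x t + B *ᵥ u t) (ξ : Fin n → ℝ)
    (η : ℕ → Fin m → ℝ) :
    ξ ⬝ᵥ x (j + k) + ∑ i ∈ Finset.range L, η i ⬝ᵥ u (i + (j + k)) =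
      (ξ ᵥ* A ^ k) ⬝ᵥ x j +
        ∑ s ∈ Finset.range (L + n), annihilatorSeq A B ξ L η (s + (n - k)) ⬝ᵥ u (s + j) := by
  obtain ⟨d, rfl⟩ := Nat.exists_eq_add_of_le hk
  rw [dotProduct_state_eq A B x u j k hx ξ, show L + (k + d) = k + L + d by omega,
    Finset.sum_range_add, Finset.sum_range_add, add_assoc]
  congr 1
  rw [Finset.sum_eq_zero (s := Finset.range d), add_zero]
  · congr 1
    · refine Finset.sum_congr rfl fun s hs => ?_
      have hs := Finset.mem_range.1 hs
      rw [annihilatorSeq, if_pos (by omega), add_comm j s,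
        show k + d - 1 - (s + (k + d - k)) = k - 1 - s by omega]
    · refine Finset.sum_congr rfl fun s hs => ?_
      have hs := Finset.mem_range.1 hs
      rw [annihilatorSeq, if_neg (by omega), if_pos (by omega)]
      congr 2 <;> omega
  · intro s _
    rw [annihilatorSeq, if_neg (by omega), if_neg (by omega), zero_dotProduct]

theorem eq_zero_of_monic_recurrence {V : Type*} [AddCommGroup V] [Module ℝ V] (n N : ℕ)
    (c : ℕ → ℝ) (hc : c n = 1) (w : ℕ → V) (hw : ∀ i, N ≤ i → w i = 0)
    (hrec : ∀ s < N, ∑ k ∈ Finset.range (n + 1), c k • w (s + (n - k)) = 0) (i : ℕ) :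
    w i = 0 := by
  by_cases hi : N ≤ i
  · exact hw i hi
  have h := hrec i (by omega)
  rw [Finset.sum_range_succ, hc, Finset.sum_eq_zero] at h
  · simpa using h
  · intro k hk
    have hk := Finset.mem_range.1 hk
    rw [eq_zero_of_monic_recurrence n N c hc w hw hrec (i + (n - k)), smul_zero]
termination_by N - i
decreasing_by omega


open Polynomial in
/-- The depth-`L` input Hankel matrix stacked below the initial states has trivial left kernel. -/
theorem state_input_left_kernel_eq_zero {n m : ℕ} (T L : ℕ) (A : Matrix (Fin n) (Fin n) ℝ)
    (B : Matrix (Fin n) (Fin m) ℝ) (hctrb : (ctrbMatrix n m A B).rank = n) (hLnT : L + n ≤ T)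
    (x : ℕ → Fin n → ℝ) (u : ℕ → Fin m → ℝ)
    (hx : ∀ t < T, x (t + 1) = A *ᵥ x t + B *ᵥ u t)
    (hPE : ∀ v : ℕ → Fin m → ℝ,
      (∀ j ≤ T - (L + n), ∑ s ∈ Finset.range (L + n), v s ⬝ᵥ u (s + j) = 0) →
        ∀ s < L + n, v s = 0)
    (ξ : Fin n → ℝ) (η : ℕ → Fin m → ℝ)
    (h : ∀ j ≤ T - L, ξ ⬝ᵥ x j + ∑ i ∈ Finset.range L, η i ⬝ᵥ u (i + j) = 0) :
    ξ = 0 ∧ ∀ i < L, η i = 0 := by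
  have hdeg : A.charpoly.natDegree = n := by simp [Matrix.charpoly_natDegree_eq_dim]
  have hCH : ∑ k ∈ Finset.range (n + 1), A.charpoly.coeff k • A ^ k = 0 := by
    have := A.aeval_self_charpoly
    rwa [aeval_eq_sum_range, hdeg] at this
  have hlead : A.charpoly.coeff n = 1 := by
    have := A.charpoly_monic.coeff_natDegree
    rwa [hdeg] at this
  set w := annihilatorSeq A B ξ L η with hw
  have hw0 : ∀ i, w i = 0 := by
    refine eq_zero_of_monic_recurrence n (L + n) A.charpoly.coeff hlead w ?_ ?_
    · intro i hi
      rw [hw, annihilatorSeq, if_neg (by omega), if_neg (by omega)]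
    · refine hPE _ fun j hj => ?_
      have hsum : ∑ k ∈ Finset.range (n + 1), A.charpoly.coeff k * ((ξ ᵥ* A ^ k) ⬝ᵥ x j +
          ∑ s ∈ Finset.range (L + n), w (s + (n - k)) ⬝ᵥ u (s + j)) = 0 := by
        refine Finset.sum_eq_zero fun k hk => ?_
        have hk := Finset.mem_range.1 hk
        rw [hw, ← annihilatorSeq_shift A B x u L j k (by omega) (fun t ht => hx t (by omega)),
          h (j + k) (by omega), mul_zero]
      have hfree : ∑ k ∈ Finset.range (n + 1),
          A.charpoly.coeff k * ((ξ ᵥ* A ^ k) ⬝ᵥ x j) = 0 := by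
        have := congrArg (fun M : Matrix (Fin n) (Fin n) ℝ => ξ ⬝ᵥ (M *ᵥ x j)) hCH
        simpa [Matrix.sum_mulVec, dotProduct_sum, Matrix.smul_mulVec, dotProduct_mulVec]
          using this
      simp only [mul_add, Finset.sum_add_distrib, hfree, zero_add, Finset.mul_sum] at hsum
      rw [Finset.sum_comm] at hsum
      simpa [sum_dotProduct] using hsum
  refine ⟨vecMul_injective_of_rank_eq_card (ctrbMatrix n m A B) (by simpa using hctrb) ξ ?_, ?_⟩
  · ext ⟨k, l⟩
    have h1 := congrFun (hw0 (n - 1 - k)) l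
    rw [hw, annihilatorSeq, if_pos (by omega), show n - 1 - (n - 1 - (k : ℕ)) = k by omega] at h1
    exact h1
  · intro i hi
    have h1 := hw0 (i + n)
    rwa [hw, annihilatorSeq, if_neg (by omega), if_pos (by omega), Nat.add_sub_cancel] at h1

/-- A finite signal extended by zero to all natural times. -/
def zeroExtend {N q : ℕ} (w : Fin N → Fin q → ℝ) (t : ℕ) : Fin q → ℝ :=
  if h : t < N then w ⟨t, h⟩ else 0

theorem zeroExtend_of_lt {N q : ℕ} (w : Fin N → Fin q → ℝ) {t : ℕ} (h : t < N) :
    zeroExtend w t = w ⟨t, h⟩ :=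
  dif_pos h

theorem zeroExtend_val {N q : ℕ} (w : Fin N → Fin q → ℝ) (t : Fin N) :
    zeroExtend w t = w t :=
  dif_pos t.isLt

theorem blockHankel_apply_eq_zeroExtend {T L q : ℕ} (hL : L ≤ T) (w : Fin T → Fin q → ℝ)
    (ik : Fin L × Fin q) (j : Fin (T - L + 1)) :
    blockHankel T L q hL w ik j = zeroExtend w (ik.1 + j) ik.2 := by
  rw [zeroExtend_of_lt w (by omega)]
  rfl

theorem vecMul_blockHankel {T L q : ℕ} (hL : L ≤ T) (w : Fin T → Fin q → ℝ)
    (v : ℕ → Fin q → ℝ) (j : Fin (T - L + 1)) :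
    ((fun ik : Fin L × Fin q => v ik.1 ik.2) ᵥ* blockHankel T L q hL w) j =
      ∑ s ∈ Finset.range L, v s ⬝ᵥ zeroExtend w (s + j) := by
  simp only [vecMul, dotProduct, Fintype.sum_prod_type, blockHankel_apply_eq_zeroExtend,
    Finset.sum_range]

theorem blockHankel_mulVec_eq_iff {T L q : ℕ} (hL : L ≤ T) (w : Fin T → Fin q → ℝ)
    (g : Fin (T - L + 1) → ℝ) (v : Fin L → Fin q → ℝ) :
    (blockHankel T L q hL w) *ᵥ g = (fun ik => v ik.1 ik.2) ↔
      ∀ t : Fin L, ∑ j, g j • zeroExtend w (t + j) = v t := by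
  simp only [funext_iff, Prod.forall, mulVec, dotProduct, blockHankel_apply_eq_zeroExtend,
    Finset.sum_apply, Pi.smul_apply, smul_eq_mul, mul_comm]

theorem eq_zero_of_blockHankel_rank {T N q : ℕ} (hN : N ≤ T) (w : Fin T → Fin q → ℝ)
    (hPE : (blockHankel T N q hN w).rank = q * N) (v : ℕ → Fin q → ℝ)
    (hv : ∀ j ≤ T - N, ∑ s ∈ Finset.range N, v s ⬝ᵥ zeroExtend w (s + j) = 0) (s : ℕ)
    (hs : s < N) : v s = 0 := by
  have h0 := vecMul_injective_of_rank_eq_card (blockHankel T N q hN w)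
    (by simp [hPE, mul_comm]) (fun ik => v ik.1 ik.2) (by
      ext j
      rw [vecMul_blockHankel]
      exact hv j (by omega))
  ext k
  exact congrFun h0 (⟨s, hs⟩, k)

theorem exists_combination_state_input {n m : ℕ} (T L : ℕ) (A : Matrix (Fin n) (Fin n) ℝ)
    (B : Matrix (Fin n) (Fin m) ℝ) (hctrb : (ctrbMatrix n m A B).rank = n) (hLT : L ≤ T)
    (hLnT : L + n ≤ T)
    (x : ℕ → Fin n → ℝ) (ud : Fin T → Fin m → ℝ)
    (hx : ∀ t < T, x (t + 1) = A *ᵥ x t + B *ᵥ zeroExtend ud t)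
    (hPE : (blockHankel T (L + n) m hLnT ud).rank = m * (L + n))
    (x₀ : Fin n → ℝ) (u : Fin L → Fin m → ℝ) :
    ∃ g : Fin (T - L + 1) → ℝ, ∑ j, g j • x j = x₀ ∧
      (blockHankel T L m hLT ud) *ᵥ g = fun ik => u ik.1 ik.2 := by
  obtain ⟨g, hg⟩ := mulVec_surjective_of_vecMul_eq_zero
    (fromRows (Matrix.of fun i (j : Fin (T - L + 1)) => x j i)
      (blockHankel T L m hLT ud)) (by
      intro v hv
      have h0 := state_input_left_kernel_eq_zero T L A B hctrb hLnT x (zeroExtend ud) hx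
        (eq_zero_of_blockHankel_rank hLnT ud hPE) (fun i => v (Sum.inl i))
        (zeroExtend fun i k => v (Sum.inr (i, k))) (by
          intro j hj
          have hj' := congrFun hv ⟨j, by omega⟩
          rw [vecMul_fromRows, Pi.add_apply] at hj'
          have h2 := vecMul_blockHankel hLT ud
            (zeroExtend fun (i : Fin L) k => v (Sum.inr (i, k))) ⟨j, by omega⟩
          simp only [zeroExtend_val] at h2
          rw [← h2]
          exact hj')
      ext (i | ⟨i, k⟩)
      · exact congrFun h0.1 i
      · have h1 := congrFun (h0.2 i i.isLt) k
        rwa [zeroExtend_val] at h1)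
    (Sum.elim x₀ fun ik => u ik.1 ik.2)
  rw [fromRows_mulVec] at hg
  refine ⟨g, ?_, ?_⟩
  · ext i
    have := congrFun hg (Sum.inl i)
    simpa [mulVec, dotProduct, mul_comm] using this
  · ext ik
    exact congrFun hg (Sum.inr ik)

theorem sum_smul_mulVec_add {ι : Type*} [Fintype ι] {a b c : ℕ} (M : Matrix (Fin c) (Fin a) ℝ)
    (N : Matrix (Fin c) (Fin b) ℝ) (g : ι → ℝ) (x : ι → Fin a → ℝ) (u : ι → Fin b → ℝ) :
    ∑ j, g j • (M *ᵥ x j + N *ᵥ u j) = M *ᵥ (∑ j, g j • x j) + N *ᵥ (∑ j, g j • u j) := by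
  simp only [mulVec_sum, mulVec_smul, smul_add, Finset.sum_add_distrib]


/-- **Willems' fundamental lemma.** Suppose `(A, B)` is controllable, the data
`(uᵈ, xᵈ, yᵈ)` of length `T` is generated by the LTI system `(A, B, C, D)`, and `uᵈ`
is persistently exciting of order `L + n`. Then `(u, y)` is a length-`L` input–output
trajectory of the system if and only if the stacked vectors of `u` and `y` lie in the
column span of the depth-`L` Hankel matrices of `uᵈ` and `yᵈ` with a common
coefficient vector `g`. -/
theorem fundamental_lemma (n m p T L : ℕ) (hT : 0 < T) (hL : 0 < L)
    (A : Matrix (Fin n) (Fin n) ℝ) (B : Matrix (Fin n) (Fin m) ℝ)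
    (C : Matrix (Fin p) (Fin n) ℝ) (D : Matrix (Fin p) (Fin m) ℝ)
    (hctrb : (ctrbMatrix n m A B).rank = n)
    (hLnT : L + n ≤ T)
    (ud : Fin T → Fin m → ℝ) (xd : Fin (T + 1) → Fin n → ℝ) (yd : Fin T → Fin p → ℝ)
    (hdyn : ∀ t : Fin T,
      xd t.succ = A.mulVec (xd t.castSucc) + B.mulVec (ud t) ∧
      yd t = C.mulVec (xd t.castSucc) + D.mulVec (ud t))
    (hPE : (blockHankel T (L + n) m hLnT ud).rank = m * (L + n))
    (u : Fin L → Fin m → ℝ) (y : Fin L → Fin p → ℝ) :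
    (∃ g : Fin (T - L + 1) → ℝ,
        (blockHankel T L m (by omega) ud).mulVec g = (fun ik => u ik.1 ik.2) ∧
        (blockHankel T L p (by omega) yd).mulVec g = (fun ik => y ik.1 ik.2))
      ↔
    (∃ x : Fin (L + 1) → Fin n → ℝ, ∀ t : Fin L,
        x t.succ = A.mulVec (x t.castSucc) + B.mulVec (u t) ∧
        y t = C.mulVec (x t.castSucc) + D.mulVec (u t)) := by
  have hx : ∀ t < T, zeroExtend xd (t + 1) =
      A *ᵥ zeroExtend xd t + B *ᵥ zeroExtend ud t := by
    intro t ht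
    rw [zeroExtend_of_lt xd (by omega), zeroExtend_of_lt xd (by omega), zeroExtend_of_lt ud ht]
    exact (hdyn ⟨t, ht⟩).1
  have hy : ∀ t < T, zeroExtend yd t = C *ᵥ zeroExtend xd t + D *ᵥ zeroExtend ud t := by
    intro t ht
    rw [zeroExtend_of_lt xd (by omega), zeroExtend_of_lt ud ht, zeroExtend_of_lt yd ht]
    exact (hdyn ⟨t, ht⟩).2
  have hstep (g : Fin (T - L + 1) → ℝ) (t : ℕ) (ht : t < L) :
      ∑ j : Fin (T - L + 1), g j • zeroExtend xd (t + 1 + j) =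
        A *ᵥ (∑ j : Fin (T - L + 1), g j • zeroExtend xd (t + j)) +
          B *ᵥ (∑ j : Fin (T - L + 1), g j • zeroExtend ud (t + j)) := by
    rw [← sum_smul_mulVec_add]
    refine Finset.sum_congr rfl fun j _ => ?_
    rw [← hx (t + j) (by omega), add_right_comm]
  have hout (g : Fin (T - L + 1) → ℝ) (t : ℕ) (ht : t < L) :
      ∑ j : Fin (T - L + 1), g j • zeroExtend yd (t + j) =
        C *ᵥ (∑ j : Fin (T - L + 1), g j • zeroExtend xd (t + j)) +
          D *ᵥ (∑ j : Fin (T - L + 1), g j • zeroExtend ud (t + j)) := by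
    rw [← sum_smul_mulVec_add]
    refine Finset.sum_congr rfl fun j _ => ?_
    rw [← hy (t + j) (by omega)]
  constructor
  · rintro ⟨g, hgu, hgy⟩
    rw [blockHankel_mulVec_eq_iff] at hgu hgy
    refine ⟨fun t => ∑ j : Fin (T - L + 1), g j • zeroExtend xd (t + j), fun t => ⟨?_, ?_⟩⟩
    · rw [← hgu t]
      exact hstep g t t.isLt
    · rw [← hgu t, ← hgy t]
      exact hout g t t.isLt
  · rintro ⟨x, hxu⟩
    obtain ⟨g, hg0, hgu⟩ := exists_combination_state_input T L A B hctrb (by omega)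
      hLnT (zeroExtend xd) ud hx hPE (x 0) u
    refine ⟨g, hgu, ?_⟩
    rw [blockHankel_mulVec_eq_iff] at hgu ⊢
    have hstate : ∀ t : Fin (L + 1),
        ∑ j : Fin (T - L + 1), g j • zeroExtend xd (t + j) = x t := by
      intro t
      induction t using Fin.induction with
      | zero => simpa using hg0
      | succ t ih =>
        rw [(hxu t).1, ← ih, ← hgu t]
        exact hstep g t t.isLt
    intro t
    rw [(hxu t).2, ← hstate t.castSucc, ← hgu t]
    exact hout g t t.isLt
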